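/- Let $\Bbbk$ be a field and let $m_1, n_1, m_2, n_2$ be non-negative integers with $(m_1,n_1) \neq (0,0)$, $(m_2,n_2) \neq (0,0)$, and $m_1 n_2 - m_2 n_1 \neq 0$. Then the polynomials $X^{m_1} Y^{n_1} - 1$ and $X^{m_2} Y^{n_2} - 1$ have no non-constant common factor in $\Bbbk[X,Y]$. -/

import Mathlib

open MvPolynomial

theorem pow_sub_eq_one_of_mul_eq_one {M : Type*} [CommMonoid M] {x u : M} {a c : ℕ}
    (hac : a ≤ c) (ha : x ^ a * u = 1) (hc : x ^ c * u = 1) : x ^ (c - a) = 1 := by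
  rw [← Nat.sub_add_cancel hac, pow_add, mul_assoc, ha, mul_one] at hc
  exact hc

theorem exists_pow_eq_one_of_pow_mul_pow_eq_one {M : Type*} [CommMonoid M] {x y : M}
    {a b c e : ℕ} (h : a * e ≠ c * b) (h₁ : x ^ a * y ^ b = 1) (h₂ : x ^ c * y ^ e = 1) :
    ∃ d ≠ 0, x ^ d = 1 := by
  have k₁ : x ^ (a * e) * y ^ (b * e) = 1 := by
    rw [pow_mul, pow_mul, ← mul_pow, h₁, one_pow]
  have k₂ : x ^ (c * b) * y ^ (b * e) = 1 := by
    rw [mul_comm b e, pow_mul, pow_mul, ← mul_pow, h₂, one_pow]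
  rcases h.lt_or_gt with hlt | hlt
  · exact ⟨_, (Nat.sub_pos_of_lt hlt).ne', pow_sub_eq_one_of_mul_eq_one hlt.le k₁ k₂⟩
  · exact ⟨_, (Nat.sub_pos_of_lt hlt).ne', pow_sub_eq_one_of_mul_eq_one hlt.le k₂ k₁⟩

theorem MvPolynomial.degreeOf_eq_zero_of_dvd_X_pow_sub_one {σ R : Type*} [CommRing R]
    [IsDomain R] {f : MvPolynomial σ R} {i j : σ} (hij : i ≠ j) {d : ℕ} (hd : d ≠ 0)
    (h : f ∣ X j ^ d - 1) : f.degreeOf i = 0 := by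
  have hne : (X j ^ d - 1 : MvPolynomial σ R) ≠ 0 := by
    intro h0
    have hdeg := congrArg (degreeOf j) (sub_eq_zero.mp h0)
    rw [degreeOf_X_self_pow, degreeOf_one] at hdeg
    exact hd hdeg
  obtain ⟨g, hg⟩ := h
  have hle := degreeOf_sub_le i (X j ^ d : MvPolynomial σ R) 1
  rw [degreeOf_X_pow_of_ne d hij, degreeOf_one, hg] at hle
  rw [hg] at hne
  rw [degreeOf_mul_eq (left_ne_zero_of_mul hne) (right_ne_zero_of_mul hne)] at hle
  lia

/-- For a field `𝕜` and non-negative integers `m₁, n₁, m₂, n₂`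
with `(mᵢ, nᵢ) ≠ (0,0)` and `m₁ n₂ - m₂ n₁ ≠ 0`, the polynomials
`X^{m₁} Y^{n₁} - 1` and `X^{m₂} Y^{n₂} - 1` have no non-constant common
factor in `𝕜[X,Y]`. -/
theorem stmt2 {𝕜 : Type*} [Field 𝕜] (m₁ n₁ m₂ n₂ : ℕ)
    (h1 : (m₁, n₁) ≠ (0, 0)) (h2 : (m₂, n₂) ≠ (0, 0))
    (hdet : m₁ * n₂ ≠ m₂ * n₁) :
    ¬∃ f : MvPolynomial (Fin 2) 𝕜, 0 < f.totalDegree ∧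
      f ∣ (X 0) ^ m₁ * (X 1) ^ n₁ - 1 ∧ f ∣ (X 0) ^ m₂ * (X 1) ^ n₂ - 1 := by
  rintro ⟨f, hf, hf₁, hf₂⟩
  have toQuot (p : MvPolynomial (Fin 2) 𝕜) :
      f ∣ p - 1 ↔ Ideal.Quotient.mk (Ideal.span {f}) p = 1 := by
    rw [← map_one (Ideal.Quotient.mk (Ideal.span {f})), Ideal.Quotient.eq,
      Ideal.mem_span_singleton]
  rw [toQuot, map_mul, map_pow, map_pow] at hf₁ hf₂
  obtain ⟨d, hd, hX⟩ := exists_pow_eq_one_of_pow_mul_pow_eq_one hdet hf₁ hf₂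
  rw [mul_comm] at hf₁ hf₂
  obtain ⟨e, he, hY⟩ := exists_pow_eq_one_of_pow_mul_pow_eq_one
    (fun h => hdet (by lia)) hf₁ hf₂
  rw [← map_pow, ← toQuot] at hX hY
  have hvars : f.vars = ∅ := by
    refine Finset.eq_empty_of_forall_notMem fun i hi => ?_
    rw [mem_vars_iff_degreeOf_ne_zero] at hi
    fin_cases i
    · exact hi (degreeOf_eq_zero_of_dvd_X_pow_sub_one (by decide) he hY)
    · exact hi (degreeOf_eq_zero_of_dvd_X_pow_sub_one (by decide) hd hX)
  rw [vars_eq_empty_iff_eq_C, ← totalDegree_eq_zero_iff_eq_C] at hvars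
  exact hf.ne' hvars
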